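/- Let U ⊆ ℝℙ¹ (identified with ℝ/πℤ) be open with Lebesgue measure |U| < π. Then for every ε > 0 there is C_ε > 1 such that: for any A ∈ SL(2,ℝ) whose least-expanded direction u_A⁻ (the unit eigenvector of AᵀA with eigenvalue ‖A‖^{-2}, viewed in ℝℙ¹) satisfies (u_A⁻ − ε, u_A⁻ + ε) ⊆ U, the image satisfies π − C_ε‖A‖^{-2} < |φ_A(U)| < π, where φ_A is the projective action of A and |·| is the measure on ℝ/πℤ. -/

import Mathlib

open Matrix

abbrev SL2 := Matrix.SpecialLinearGroup (Fin 2) ℝ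

/-- The operator norm of a 2x2 real matrix, acting on Euclidean `ℝ²`. -/
noncomputable def matNorm (A : Matrix (Fin 2) (Fin 2) ℝ) : ℝ :=
  ‖LinearMap.toContinuousLinearMap (Matrix.toEuclideanLin A)‖

instance : TopologicalSpace SL2 :=
  TopologicalSpace.induced (fun A => (A : Matrix (Fin 2) (Fin 2) ℝ)) inferInstance

/-- Product of the word `l` under the letter assignment `A`. -/
def wordProd {ι : Type*} (A : ι → SL2) (l : List ι) : SL2 := (l.map A).prod

/-- The zeta function `ζ_𝒜(s) = ∑_{n≥1} ∑_{A ∈ 𝒜ⁿ} ‖A‖^{-2s}`, the sum ranging over all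
nonempty words over the alphabet `ι` (valued in `ℝ≥0∞` so divergence is value `⊤`). -/
noncomputable def zeta {ι : Type*} (A : ι → SL2) (s : ℝ) : ENNReal :=
  ∑' l : {l : List ι // l ≠ []}, ENNReal.ofReal (matNorm (wordProd A l.1) ^ (-2 * s))

/-- The critical exponent `δ_𝒜 = inf {s > 0 : ζ_𝒜(s) < ∞}` (equal to `⊤` if the zeta
function always diverges). -/
noncomputable def deltaOf {ι : Type*} (A : ι → SL2) : ENNReal :=
  ⨅ s : {s : ℝ // 0 < s ∧ zeta A s < ⊤}, ENNReal.ofReal s.1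

open Real

instance : Fact (0 < π) := ⟨Real.pi_pos⟩

/-- The argument (mod π) of the image of the direction `θ` under the linear map `A`:
the projective action of `A` on `ℝℙ¹ = ℝ/πℤ`, computed on a representative. -/
noncomputable def projAct (A : Matrix (Fin 2) (Fin 2) ℝ) (θ : ℝ) : ℝ :=
  Complex.arg ⟨A 0 0 * Real.cos θ + A 0 1 * Real.sin θ,
               A 1 0 * Real.cos θ + A 1 1 * Real.sin θ⟩

/-- The projective action `φ_A : ℝℙ¹ → ℝℙ¹`, `ℝℙ¹` identified with `ℝ/πℤ`. -/
noncomputable def phiA (A : SL2) (x : AddCircle π) : AddCircle π :=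
  ((projAct (A : Matrix (Fin 2) (Fin 2) ℝ) (AddCircle.equivIco π 0 x : ℝ) : ℝ) : AddCircle π)

open MeasureTheory Set

/-- The image under `A` of the unit vector of direction `θ`, as a complex number. -/
noncomputable def imageVec (A : SL2) (θ : ℝ) : ℂ :=
  ⟨A.1 0 0 * Real.cos θ + A.1 0 1 * Real.sin θ, A.1 1 0 * Real.cos θ + A.1 1 1 * Real.sin θ⟩

lemma SL2.det_eq (A : SL2) : A.1 0 0 * A.1 1 1 - A.1 0 1 * A.1 1 0 = 1 := by
  rw [← Matrix.det_fin_two]; exact A.2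

lemma normSq_imageVec (A : SL2) (θ : ℝ) : Complex.normSq (imageVec A θ) =
    (A.1 0 0 * Real.cos θ + A.1 0 1 * Real.sin θ) ^ 2 +
      (A.1 1 0 * Real.cos θ + A.1 1 1 * Real.sin θ) ^ 2 := by
  simp only [imageVec, Complex.normSq_mk]; ring

/-- The wedge product of the images of two unit vectors is that of the vectors themselves. -/
lemma wedge_imageVec (A : SL2) (s t : ℝ) :
    (imageVec A s).re * (imageVec A t).im - (imageVec A s).im * (imageVec A t).re =
      Real.sin (t - s) := by
  rw [Real.sin_sub]
  simp only [imageVec]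
  linear_combination (Real.sin t * Real.cos s - Real.cos t * Real.sin s) * A.det_eq

lemma sq_sin_sub_le_normSq_mul (A : SL2) (s t : ℝ) :
    Real.sin (t - s) ^ 2 ≤
      Complex.normSq (imageVec A s) * Complex.normSq (imageVec A t) := by
  rw [← wedge_imageVec A s t, Complex.normSq_apply, Complex.normSq_apply]
  nlinarith [sq_nonneg ((imageVec A s).re * (imageVec A t).re +
    (imageVec A s).im * (imageVec A t).im)]

lemma imageVec_ne_zero (A : SL2) (θ : ℝ) : imageVec A θ ≠ 0 := by
  intro h
  have := wedge_imageVec A (θ - π / 2) θ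
  simp [h] at this

/-- A uniform lower bound for the expansion of `A`. -/
lemma exists_pos_le_normSq_imageVec (A : SL2) :
    ∃ c : ℝ, 0 < c ∧ ∀ θ, c ≤ Complex.normSq (imageVec A θ) := by
  set M := A.1 0 0 ^ 2 + A.1 0 1 ^ 2 + A.1 1 0 ^ 2 + A.1 1 1 ^ 2 with hM
  have hle : ∀ s, Complex.normSq (imageVec A s) ≤ M := by
    intro s
    rw [normSq_imageVec]
    nlinarith [sq_nonneg (A.1 0 0 * Real.sin s - A.1 0 1 * Real.cos s),
      sq_nonneg (A.1 1 0 * Real.sin s - A.1 1 1 * Real.cos s), Real.sin_sq_add_cos_sq s]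
  have hM0 : 0 < M := (Complex.normSq_pos.2 (imageVec_ne_zero A 0)).trans_le (hle 0)
  refine ⟨M⁻¹, inv_pos.2 hM0, fun θ => ?_⟩
  have h := sq_sin_sub_le_normSq_mul A (θ - π / 2) θ
  simp only [sub_sub_cancel, Real.sin_pi_div_two, one_pow] at h
  rw [inv_le_iff_one_le_mul₀ hM0, mul_comm]
  exact h.trans (mul_le_mul_of_nonneg_right (hle _) (Complex.normSq_nonneg _))

lemma phiA_eq (A : SL2) (x : AddCircle π) :
    phiA A x = ((imageVec A (AddCircle.equivIco π 0 x : ℝ)).arg : AddCircle π) := rfl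

lemma coe_eq_coe_iff_sin_sub {s t : ℝ} :
    (s : AddCircle π) = (t : AddCircle π) ↔ Real.sin (s - t) = 0 := by
  rw [← sub_eq_zero, ← AddCircle.coe_sub, AddCircle.coe_eq_zero_iff, Real.sin_eq_zero_iff]
  simp only [zsmul_eq_mul]

lemma coe_arg_eq_iff {z : ℂ} (hz : z ≠ 0) (s : ℝ) :
    (z.arg : AddCircle π) = (s : AddCircle π) ↔ z.re * Real.sin s = z.im * Real.cos s := by
  have hre := Complex.norm_mul_cos_arg z
  have him := Complex.norm_mul_sin_arg z
  have h0 : ‖z‖ ≠ 0 := norm_ne_zero_iff.2 hz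
  rw [coe_eq_coe_iff_sin_sub, Real.sin_sub, ← hre, ← him, ← mul_right_inj' h0]
  constructor <;> intro h <;> linarith

lemma phiA_inv_phiA (A : SL2) (x : AddCircle π) : phiA A⁻¹ (phiA A x) = x := by
  obtain ⟨θ, hθ⟩ : ∃ θ : ℝ, θ = (AddCircle.equivIco π 0 x : ℝ) := ⟨_, rfl⟩
  have hx : (θ : AddCircle π) = x := by rw [hθ, AddCircle.coe_equivIco]
  obtain ⟨s, hs⟩ : ∃ s : ℝ, s = (AddCircle.equivIco π 0 (phiA A x) : ℝ) := ⟨_, rfl⟩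
  have hsx : (s : AddCircle π) = phiA A x := by rw [hs, AddCircle.coe_equivIco]
  have h := hsx.symm
  rw [phiA_eq, coe_arg_eq_iff (imageVec_ne_zero A _), ← hθ] at h
  conv_rhs => rw [← hx]
  rw [phiA_eq, ← hs, coe_arg_eq_iff (imageVec_ne_zero _ _)]
  simp only [imageVec] at h ⊢
  simp only [Matrix.SpecialLinearGroup.coe_inv, Matrix.adjugate_fin_two, Matrix.of_apply,
    Matrix.cons_val', Matrix.cons_val_zero, Matrix.cons_val_one, Matrix.cons_val_fin_one]
  linear_combination -h

lemma image_phiA (A : SL2) (S : Set (AddCircle π)) : phiA A '' S = phiA A⁻¹ ⁻¹' S := by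
  refine congrFun (image_eq_preimage_of_inverse (phiA_inv_phiA A) fun x => ?_) S
  simpa using phiA_inv_phiA A⁻¹ x

lemma bijective_phiA (A : SL2) : Function.Bijective (phiA A) :=
  Function.bijective_iff_has_inverse.2
    ⟨phiA A⁻¹, phiA_inv_phiA A, fun x => by simpa using phiA_inv_phiA A⁻¹ x⟩

lemma continuous_imageVec (A : SL2) : Continuous (imageVec A) := by
  have : imageVec A = fun θ => (((A.1 0 0 * Real.cos θ + A.1 0 1 * Real.sin θ : ℝ) : ℂ) +
      ((A.1 1 0 * Real.cos θ + A.1 1 1 * Real.sin θ : ℝ) : ℂ) * Complex.I) := by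
    funext θ; apply Complex.ext <;> simp [imageVec, -Complex.ofReal_cos, -Complex.ofReal_sin]
  rw [this]
  fun_prop

lemma measurable_phiA (A : SL2) : Measurable (phiA A) := by
  have h : Measurable fun x : AddCircle π => ((AddCircle.equivIco π 0 x : ℝ)) :=
    measurable_subtype_coe.comp (AddCircle.measurableEquivIco π 0).measurable
  exact AddCircle.measurable_mk'.comp
    (Complex.measurable_arg.comp ((continuous_imageVec A).measurable.comp h))

lemma measurableSet_image_phiA (A : SL2) {S : Set (AddCircle π)} (hS : MeasurableSet S) :
    MeasurableSet (phiA A '' S) := by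
  rw [image_phiA]; exact measurable_phiA _ hS

lemma hasDerivAt_imageVec (A : SL2) (θ : ℝ) :
    HasDerivAt (imageVec A) ⟨-(A.1 0 0 * Real.sin θ) + A.1 0 1 * Real.cos θ,
      -(A.1 1 0 * Real.sin θ) + A.1 1 1 * Real.cos θ⟩ θ := by
  have hc := Real.hasDerivAt_cos θ
  have hs := Real.hasDerivAt_sin θ
  have h1 := ((hc.const_mul (A.1 0 0)).add (hs.const_mul (A.1 0 1))).ofReal_comp
  have h2 := ((hc.const_mul (A.1 1 0)).add (hs.const_mul (A.1 1 1))).ofReal_comp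
  refine ((h1.add (h2.mul_const Complex.I)).congr_deriv ?_).congr_of_eventuallyEq
    (Filter.Eventually.of_forall fun t => ?_)
  · apply Complex.ext <;> simp [-Complex.ofReal_cos, -Complex.ofReal_sin]
  · apply Complex.ext <;> simp [imageVec, -Complex.ofReal_cos, -Complex.ofReal_sin]

lemma hasDerivAt_arg_imageVec (A : SL2) (θ : ℝ) (h : imageVec A θ ∈ Complex.slitPlane) :
    HasDerivAt (fun t => (imageVec A t).arg) (Complex.normSq (imageVec A θ))⁻¹ θ := by
  have h1 := (hasDerivAt_imageVec A θ).clog_real h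
  have h2 := Complex.imCLM.hasFDerivAt.comp_hasDerivAt θ h1
  have h0 : Complex.normSq (imageVec A θ) ≠ 0 := by simpa using imageVec_ne_zero A θ
  refine (h2.congr_deriv (Eq.symm ?_)).congr_of_eventuallyEq
    (Filter.Eventually.of_forall fun t => (Complex.log_im _).symm)
  rw [Complex.imCLM_apply, Complex.div_im]
  field_simp
  simp only [imageVec]
  linear_combination (-(Real.sin θ ^ 2 + Real.cos θ ^ 2)) * A.det_eq -
    Real.sin_sq_add_cos_sq θ

/-- The quotient map `ℝ → ℝ/πℤ` does not increase the measure of subsets of `(-π, π]`. -/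
lemma volume_le_of_subset_insert_image_coe {E : Set (AddCircle π)} (hE : MeasurableSet E)
    {T : Set ℝ} (hT : T ⊆ Ioc (-π) π)
    (hET : E ⊆ insert 0 ((fun t : ℝ => (t : AddCircle π)) '' T)) :
    volume E ≤ volume T := by
  rw [AddCircle.add_projection_respects_measure π 0 hE]
  have hsub : (QuotientAddGroup.mk ⁻¹' E ∩ Ioc 0 (0 + π) : Set ℝ) ⊆
      {π} ∪ ((T ∩ Ioi 0) ∪ (fun y => y + -π) ⁻¹' (T \ Ioi 0)) := by
    have hinj : ∀ {a b : ℝ}, a ∈ Ioc 0 (0 + π) → b ∈ Ioc 0 (0 + π) →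
        (a : AddCircle π) = b → a = b := fun ha hb =>
      (AddCircle.coe_eq_coe_iff_of_mem_Ioc ha hb).1
    rintro y ⟨hyE, hy⟩
    rcases hET hyE with h | ⟨t, ht, h⟩
    · left
      have hπ : π ∈ Ioc 0 (0 + π) := by simp [Real.pi_pos]
      refine hinj hy hπ ?_
      rw [AddCircle.coe_period]
      exact h
    · right
      have ht' := hT ht
      by_cases h0 : 0 < t
      · left
        have : y = t := hinj hy ⟨h0, by simpa using ht'.2⟩ h.symm
        exact this ▸ ⟨ht, h0⟩
      · right
        have : y = t + π := hinj hy ⟨by linarith [ht'.1], by linarith⟩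
          (by rw [AddCircle.coe_add_period]; exact h.symm)
        simp [this, ht, h0]
  calc _ ≤ volume ({π} ∪ ((T ∩ Ioi 0) ∪ (fun y => y + -π) ⁻¹' (T \ Ioi 0)) : Set ℝ) :=
        measure_mono hsub
    _ ≤ volume {π} + (volume (T ∩ Ioi 0) + volume ((fun y => y + -π) ⁻¹' (T \ Ioi 0))) :=
        (measure_union_le _ _).trans (by gcongr; exact measure_union_le _ _)
    _ = volume T := by
        rw [Real.volume_singleton, zero_add, measure_preimage_add_right,
          measure_inter_add_sdiff _ measurableSet_Ioi]

/-- If `A` expands every direction of `S` by a factor at least `√c`, then `φ_A` contracts the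
measure of `S` by at least `c`. -/
lemma volume_image_phiA_le (A : SL2) {S : Set (AddCircle π)} (hS : MeasurableSet S)
    {c : ℝ} (hc : 0 < c)
    (h : ∀ θ : ℝ, (θ : AddCircle π) ∈ S → c ≤ Complex.normSq (imageVec A θ)) :
    volume (phiA A '' S) ≤ ENNReal.ofReal c⁻¹ * volume S := by
  set s : Set ℝ := (QuotientAddGroup.mk ⁻¹' S ∩ Ico 0 (0 + π)) ∩
    imageVec A ⁻¹' Complex.slitPlane with hs
  have hmk : MeasurableSet ((QuotientAddGroup.mk : ℝ → AddCircle π) ⁻¹' S) :=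
    AddCircle.measurable_mk' hS
  have hsm : MeasurableSet s :=
    (hmk.inter measurableSet_Ico).inter
      ((continuous_imageVec A).measurable Complex.isOpen_slitPlane.measurableSet)
  have h1 : volume (phiA A '' S) ≤ volume ((fun t => (imageVec A t).arg) '' s) := by
    refine volume_le_of_subset_insert_image_coe (measurableSet_image_phiA A hS) ?_ ?_
    · rintro _ ⟨t, -, rfl⟩
      exact Complex.arg_mem_Ioc _
    · rintro _ ⟨x, hx, rfl⟩
      rw [phiA_eq]
      have hx' : ((AddCircle.equivIco π 0 x : ℝ) : AddCircle π) = x := AddCircle.coe_equivIco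
      by_cases hsl : imageVec A (AddCircle.equivIco π 0 x : ℝ) ∈ Complex.slitPlane
      · right
        refine ⟨_, ⟨(AddCircle.equivIco π 0 x : ℝ), ⟨⟨?_, (AddCircle.equivIco π 0 x).2⟩, hsl⟩, rfl⟩,
          rfl⟩
        rw [mem_preimage]
        exact hx'.symm ▸ hx
      · left
        have him := (Complex.mem_slitPlane_iff.not.1 hsl)
        push Not at him
        have := (coe_arg_eq_iff (imageVec_ne_zero A (AddCircle.equivIco π 0 x : ℝ)) 0).2
          (by simp [him.2])
        simpa using this
  have h2 := addHaar_image_le_lintegral_abs_det_fderiv volume hsm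
    (fun t ht => (hasDerivAt_arg_imageVec A t ht.2).hasFDerivAt.hasFDerivWithinAt)
  calc _ ≤ _ := h1.trans h2
    _ ≤ ∫⁻ _ in s, ENNReal.ofReal c⁻¹ := by
        refine setLIntegral_mono' hsm fun t ht => ENNReal.ofReal_le_ofReal ?_
        rw [ContinuousLinearMap.det_toSpanSingleton,
          abs_of_nonneg (inv_nonneg.2 (Complex.normSq_nonneg _))]
        exact inv_anti₀ hc (h t ht.1.1)
    _ = ENNReal.ofReal c⁻¹ * volume s := by rw [setLIntegral_const]
    _ ≤ ENNReal.ofReal c⁻¹ * volume S := by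
        gcongr
        rw [AddCircle.add_projection_respects_measure π 0 hS,
          measure_congr ((ae_eq_refl (QuotientAddGroup.mk ⁻¹' S : Set ℝ)).inter
            (Ico_ae_eq_Ioc (a := (0 : ℝ)) (b := 0 + π)).symm)]
        exact measure_mono inter_subset_left

lemma volume_image_phiA_pos (A : SL2) {S : Set (AddCircle π)} (hS : MeasurableSet S)
    (h : 0 < volume S) : 0 < volume (phiA A '' S) := by
  obtain ⟨c, hc, hle⟩ := exists_pos_le_normSq_imageVec A⁻¹
  have h1 := volume_image_phiA_le A⁻¹ (measurableSet_image_phiA A hS) hc fun θ _ => hle θ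
  rw [image_image] at h1
  simp only [phiA_inv_phiA, image_id'] at h1
  by_contra h0
  rw [not_lt, nonpos_iff_eq_zero] at h0
  rw [h0, mul_zero] at h1
  exact absurd h (not_lt.2 h1)

lemma two_div_pi_mul_norm_le_abs_sin (x : ℝ) :
    2 / π * ‖(x : AddCircle π)‖ ≤ |Real.sin x| := by
  have h := AddCircle.norm_le_half_period π (x := (x : AddCircle π)) Real.pi_ne_zero
  rw [AddCircle.norm_eq, abs_of_pos Real.pi_pos] at h
  rw [AddCircle.norm_eq]
  refine (Real.mul_abs_le_abs_sin h).trans_eq ?_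
  rw [Real.sin_sub_int_mul_pi, abs_mul, abs_zpow, abs_neg, abs_one, _root_.one_zpow, one_mul]

lemma normSq_imageVec_of_eigenvector (A : SL2) {u r : ℝ}
    (h : (A.1ᵀ * A.1) *ᵥ ![Real.cos u, Real.sin u] = r • ![Real.cos u, Real.sin u]) :
    Complex.normSq (imageVec A u) = r := by
  have h0 := congrFun h 0
  have h1 := congrFun h 1
  simp [Matrix.mulVec, Matrix.mul_apply, dotProduct, Fin.sum_univ_two] at h0 h1
  rw [normSq_imageVec]
  linear_combination Real.cos u * h0 + Real.sin u * h1 + r * Real.sin_sq_add_cos_sq u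

/-- Let `U ⊆ ℝℙ¹ = ℝ/πℤ` be open with `|U| < π`. For every `ε > 0` there is `C_ε > 1`
such that for every `A ∈ SL(2,ℝ)` whose least-expanded direction `u_A⁻` (eigenvector of
`AᵀA` with eigenvalue `‖A‖⁻²`, as a point of `ℝ/πℤ`) has its `ε`-ball inside `U`:
`π − C_ε‖A‖⁻² < |φ_A(U)| < π`. -/
theorem stmt18 (U : Set (AddCircle π)) (hUopen : IsOpen U)
    (hU : MeasureTheory.volume U < ENNReal.ofReal π) :
    ∀ ε : ℝ, 0 < ε → ∃ C : ℝ, 1 < C ∧ ∀ (A : SL2) (u : ℝ),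
      (((A : Matrix (Fin 2) (Fin 2) ℝ)ᵀ * (A : Matrix (Fin 2) (Fin 2) ℝ)) *ᵥ
          ![Real.cos u, Real.sin u] =
        ((matNorm ((A : SL2) : Matrix (Fin 2) (Fin 2) ℝ)) ^ 2)⁻¹ •
          ![Real.cos u, Real.sin u]) →
      Metric.ball ((u : AddCircle π)) ε ⊆ U →
      ENNReal.ofReal (π - C * ((matNorm ((A : SL2) : Matrix (Fin 2) (Fin 2) ℝ)) ^ 2)⁻¹)
          < MeasureTheory.volume (phiA A '' U) ∧
        MeasureTheory.volume (phiA A '' U) < ENNReal.ofReal π := by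
  intro ε hε
  have hπ := Real.pi_pos
  set K : ℝ := π ^ 2 / (4 * ε ^ 2) with hK
  have hK0 : 0 < K := by positivity
  refine ⟨K * π + 2, by nlinarith [mul_pos hK0 hπ], fun A u hu hball => ?_⟩
  set r : ℝ := (matNorm (A : Matrix (Fin 2) (Fin 2) ℝ) ^ 2)⁻¹ with hr
  have hnr : Complex.normSq (imageVec A u) = r := normSq_imageVec_of_eigenvector A hu
  have hr0 : 0 < r := hnr ▸ Complex.normSq_pos.2 (imageVec_ne_zero A u)
  have hc : 0 < (K * r)⁻¹ := by positivity
  have hUc : MeasurableSet Uᶜ := hUopen.measurableSet.compl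
  have hW : volume (phiA A '' Uᶜ) ≤ ENNReal.ofReal (K * r * π) := by
    refine (volume_image_phiA_le A hUc hc fun θ hθ => ?_).trans ?_
    · have hd : ε ≤ ‖((θ - u : ℝ) : AddCircle π)‖ := by
        by_contra hlt
        refine hθ (hball ?_)
        rw [Metric.mem_ball, dist_eq_norm, ← AddCircle.coe_sub]
        exact not_le.1 hlt
      have hs : 2 / π * ε ≤ |Real.sin (θ - u)| :=
        (mul_le_mul_of_nonneg_left hd (by positivity)).trans (two_div_pi_mul_norm_le_abs_sin _)
      have hs2 : K⁻¹ ≤ Real.sin (θ - u) ^ 2 := by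
        rw [← sq_abs (Real.sin _)]
        refine le_trans (le_of_eq ?_) (pow_le_pow_left₀ (by positivity) hs 2)
        rw [hK]; field_simp; norm_num
      have hm := hs2.trans (sq_sin_sub_le_normSq_mul A u θ)
      rw [hnr] at hm
      rw [mul_inv, ← div_eq_mul_inv, div_le_iff₀' hr0]
      exact hm
    · rw [inv_inv, ENNReal.ofReal_mul (by positivity : 0 ≤ K * r)]
      gcongr
      exact (measure_mono (subset_univ _)).trans_eq (AddCircle.measure_univ π)
  have hVpos : 0 < volume (phiA A '' U) :=
    volume_image_phiA_pos A hUopen.measurableSet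
      (hUopen.measure_pos volume ⟨_, hball (Metric.mem_ball_self hε)⟩)
  have hWpos : 0 < volume (phiA A '' Uᶜ) := by
    refine volume_image_phiA_pos A hUc ?_
    rw [measure_compl hUopen.measurableSet (measure_ne_top _ _), AddCircle.measure_univ]
    exact tsub_pos_of_lt hU
  have hadd : volume (phiA A '' U) + volume (phiA A '' Uᶜ) = ENNReal.ofReal π := by
    rw [image_compl_eq (bijective_phiA A),
      measure_add_measure_compl (measurableSet_image_phiA A hUopen.measurableSet),
      AddCircle.measure_univ]
  refine ⟨?_, ?_⟩
  · by_contra hle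
    rw [not_lt] at hle
    have hpos : 0 < π - (K * π + 2) * r := ENNReal.ofReal_pos.1 (hVpos.trans_le hle)
    have h1 := add_le_add hle hW
    rw [hadd, ← ENNReal.ofReal_add hpos.le (by positivity),
      ENNReal.ofReal_le_ofReal_iff (by positivity)] at h1
    nlinarith
  · rw [← hadd]
    exact ENNReal.lt_add_right (measure_ne_top _ _) hWpos.ne'
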